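/- Let 𝔖 be a compatible split system on a finite multiset 𝓜. Then the isomorphism classes of 𝓜-trees representing 𝔖 are in bijective correspondence with the isomorphism classes of consistent thin subgraphs of Γ(𝔖). In particular, 𝔖 has a unique representation up to isomorphism if and only if Γ(𝔖) has a unique consistent thin subgraph up to isomorphism. -/

import Mathlib

open scoped Classical

/-- A split of a multiset `M`: an unordered pair of nonempty submultisets of `M`
whose multiset union is `M`. -/
def IsSplit {X : Type} (M : Multiset X) (S : Sym2 (Multiset X)) : Prop :=
  ∃ A B : Multiset X, S = s(A, B) ∧ A ≠ 0 ∧ B ≠ 0 ∧ A + B = M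

/-- A split system on `M`: a multiset of splits of `M`. -/
def IsSplitSystem {X : Type} (M : Multiset X) (𝔖 : Multiset (Sym2 (Multiset X))) : Prop :=
  ∀ S ∈ 𝔖, IsSplit M S

/-- An `M`-tree: a finite tree whose vertices are labelled by submultisets of `M`
such that (M1) the multiset union of all labels is `M`, and (M2) every vertex of
degree 1 or 2 has a nonempty label. -/
structure MTree (X : Type) (M : Multiset X) where
  n : ℕ
  G : SimpleGraph (Fin n)
  connected : G.Connected
  acyclic : G.IsAcyclic
  label : Fin n → Multiset X
  m1 : ∑ v, label v = M
  m2 : ∀ v, G.degree v = 1 ∨ G.degree v = 2 → label v ≠ 0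

namespace MTree

variable {X : Type} {M : Multiset X}

/-- The part of the split induced by the edge `{u, v}` lying on the side of `u`:
the multiset union of the labels of the vertices in the connected component of `u`
after deleting the edge `{u, v}`. -/
noncomputable def part (T : MTree X M) (u v : Fin T.n) : Multiset X :=
  ∑ w ∈ Finset.univ.filter (fun w => (T.G.deleteEdges {s(u, v)}).Reachable u w), T.label w

/-- The multiset of splits represented by an `M`-tree: the splits induced by its edges. -/
noncomputable def splits (T : MTree X M) : Multiset (Sym2 (Multiset X)) :=
  T.G.edgeFinset.val.map
    (Sym2.lift ⟨fun u v => s(T.part u v, T.part v u), fun u v => Sym2.eq_swap⟩)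

end MTree

/-- A split system on `M` is compatible if some `M`-tree represents it. -/
def Compatible {X : Type} (M : Multiset X) (𝔖 : Multiset (Sym2 (Multiset X))) : Prop :=
  ∃ T : MTree X M, T.splits = 𝔖

/-- `Δ(M) = Σ_{x ∈ X} (M(x) - 1)`. -/
def delta {X : Type} [DecidableEq X] (M : Multiset X) : ℕ :=
  ∑ x ∈ M.toFinset, (M.count x - 1)

/-- The split system `{S₁, …, Sₙ}` determined by an indexed family of ordered splits,
where split `i` has parts `P i true` and `P i false`. -/
def splitSystemOf {X : Type} {n : ℕ} (P : Fin n → Bool → Multiset X) :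
    Multiset (Sym2 (Multiset X)) :=
  (Finset.univ.val : Multiset (Fin n)).map fun i => s(P i true, P i false)

/-- The arcs of the split-containment graph `Γ(𝔖)`: its vertices are the pairs
`(i, b)` (representing the pair `(P i b, Sᵢ)` of a part of the split `Sᵢ` together
with `Sᵢ`), and there is an arc from `(i, b)` to `(j, c)` iff `i ≠ j` and
`P i b ⊊ P j c` as multisets. -/
def GammaArc {X : Type} {n : ℕ} (P : Fin n → Bool → Multiset X)
    (u v : Fin n × Bool) : Prop :=
  u.1 ≠ v.1 ∧ P u.1 u.2 < P v.1 v.2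

/-- A thin subgraph of `Γ(𝔖)`: a spanning subgraph `G` of `Γ(𝔖)` such that for all
distinct `i, j` the restriction of `G` to the four vertices coming from `Sᵢ` and `Sⱼ`
has exactly two arcs, of the form `((C,Sᵢ),(D,Sⱼ))` and `((D̄,Sⱼ),(C̄,Sᵢ))`. -/
def IsThinSubgraph {X : Type} {n : ℕ} (P : Fin n → Bool → Multiset X)
    (G : Fin n × Bool → Fin n × Bool → Prop) : Prop :=
  (∀ u v, G u v → GammaArc P u v) ∧
  ∀ i j : Fin n, i ≠ j → ∃ b c : Bool, ∀ b' c' : Bool,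
    (G (i, b') (j, c') ↔ b' = b ∧ c' = c) ∧
    (G (j, c') (i, b') ↔ c' = !c ∧ b' = !b)

/-- An arc `(u, v)` of a digraph `G` is critical if the only directed path in `G`
from `u` to `v` is the arc itself. -/
def IsCriticalArc {V : Type} (G : V → V → Prop) (u v : V) : Prop :=
  G u v ∧ ¬ ∃ w, G u w ∧ w ≠ v ∧ Relation.TransGen G w v

/-- A (thin) subgraph `G` of `Γ(𝔖)` is consistent if for every vertex `(A, Sᵢ)` of `G`,
the multiset union of the parts `B` over all vertices `(B, Sⱼ)` such that
`((B,Sⱼ),(A,Sᵢ))` is a critical arc of `G` is a submultiset of `A`. -/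
def IsConsistent {X : Type} {n : ℕ} (P : Fin n → Bool → Multiset X)
    (G : Fin n × Bool → Fin n × Bool → Prop) : Prop :=
  ∀ u : Fin n × Bool,
    (∑ w ∈ Finset.univ.filter (fun w => IsCriticalArc G w u), P w.1 w.2) ≤ P u.1 u.2

/-- A part `A` of a split `A|Ā ∈ 𝔖` is a terminal set of `𝔖` if for every split
`B|B̄` of `𝔖` other than (this occurrence of) `A|Ā`, neither `B ⊊ A` nor `B̄ ⊊ A`. -/
def IsTerminal {X : Type} [DecidableEq X] (M : Multiset X)
    (𝔖 : Multiset (Sym2 (Multiset X))) (A : Multiset X) : Prop :=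
  s(A, M - A) ∈ 𝔖 ∧ ∀ T ∈ 𝔖.erase s(A, M - A), ∀ B ∈ T, ¬ B < A

/-- A terminal set `A` of `𝔖` is a superterminal set if in addition, for every split
`B|B̄` of `𝔖` other than `A|Ā`, exactly one of `A ⊊ B`, `A ⊊ B̄` holds. -/
def IsSuperterminal {X : Type} [DecidableEq X] (M : Multiset X)
    (𝔖 : Multiset (Sym2 (Multiset X))) (A : Multiset X) : Prop :=
  IsTerminal M 𝔖 A ∧
    ∀ T ∈ 𝔖.erase s(A, M - A), ∀ B C : Multiset X, T = s(B, C) → (A < B ↔ ¬ A < C)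

/-- Two splits are compatible if they have parts `A ∈ S₁`, `B ∈ S₂` with `A ∩ B = ∅`
(multiset intersection). -/
def SplitPairCompatible {X : Type} [DecidableEq X] (S₁ S₂ : Sym2 (Multiset X)) : Prop :=
  ∃ A ∈ S₁, ∃ B ∈ S₂, A ∩ B = 0

/-- A split system is pairwise compatible if any two of its splits are compatible. -/
def PairwiseCompatible {X : Type} [DecidableEq X] (𝔖 : Multiset (Sym2 (Multiset X))) : Prop :=
  ∀ S₁ ∈ 𝔖, ∀ S₂ ∈ 𝔖.erase S₁, SplitPairCompatible S₁ S₂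

/-- The size of a split `A|B` is `min {|A|, |B|}`. -/
def splitSize {X : Type} : Sym2 (Multiset X) → ℕ :=
  Sym2.lift ⟨fun A B => min A.card B.card, fun A B => min_comm _ _⟩

/-- Isomorphism of `M`-trees: a graph isomorphism preserving the labels. -/
def MTreeIso {X : Type} {M : Multiset X} (T T' : MTree X M) : Prop :=
  ∃ φ : Fin T.n ≃ Fin T'.n,
    (∀ u v, T.G.Adj u v ↔ T'.G.Adj (φ u) (φ v)) ∧ ∀ v, T'.label (φ v) = T.label v

/-- Isomorphism of digraphs. -/
def DigraphIso {V W : Type} (R : V → V → Prop) (Q : W → W → Prop) : Prop :=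
  ∃ φ : V ≃ W, ∀ a b, R a b ↔ Q (φ a) (φ b)

/-- The digraph `D₁` on the four vertices `v = 0`, `w = 1`, `p = 2`, `q = 3`,
with arcs `(v,p)` and `(q,w)`. -/
def D1 : Fin 4 → Fin 4 → Prop := fun a b => (a = 0 ∧ b = 2) ∨ (a = 3 ∧ b = 1)

/-- The digraph `D₂` on the four vertices `v = 0`, `w = 1`, `p = 2`, `q = 3`,
with arcs `(v,p)`, `(p,w)`, `(v,q)` and `(q,w)`. -/
def D2 : Fin 4 → Fin 4 → Prop :=
  fun a b => (a = 0 ∧ b = 2) ∨ (a = 2 ∧ b = 1) ∨ (a = 0 ∧ b = 3) ∨ (a = 3 ∧ b = 1)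

/-- Isomorphism of subgraphs of `Γ(𝔖)`: a digraph isomorphism mapping each vertex
`(A, Sᵢ)` to a vertex `(B, Sⱼ)` with `A = B`. -/
def SubgraphIso {X : Type} {n : ℕ} (P : Fin n → Bool → Multiset X)
    (G G' : Fin n × Bool → Fin n × Bool → Prop) : Prop :=
  ∃ φ : Fin n × Bool ≃ Fin n × Bool,
    (∀ u v, G u v ↔ G' (φ u) (φ v)) ∧ ∀ u, P (φ u).1 (φ u).2 = P u.1 u.2


namespace SimpleGraph

variable {V : Type} {Gr : SimpleGraph V}

theorem Dart.edge_mk_ne {d e : Gr.Dart} (h : d ≠ e) (h' : d ≠ e.symm) :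
    s(d.fst, d.snd) ≠ s(e.fst, e.snd) := by
  intro h''
  rcases (dart_edge_eq_iff d e).1 h'' with h1 | h1
  · exact h h1
  · exact h' h1

variable [Fintype V]

/-- The vertices lying on the side of the source of the dart `d` after deleting its edge. -/
noncomputable def Dart.side (d : Gr.Dart) : Finset V :=
  Finset.univ.filter (fun w => (Gr.deleteEdges {s(d.fst, d.snd)}).Reachable d.fst w)

theorem Dart.mem_side {d : Gr.Dart} {w : V} :
    w ∈ d.side ↔ (Gr.deleteEdges {s(d.fst, d.snd)}).Reachable d.fst w := by
  simp [Dart.side]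

theorem Dart.fst_mem_side (d : Gr.Dart) : d.fst ∈ d.side :=
  Dart.mem_side.2 (Reachable.refl _)

theorem Dart.mem_side_symm_iff_reachable {d : Gr.Dart} {w : V} :
    w ∈ d.symm.side ↔ (Gr.deleteEdges {s(d.fst, d.snd)}).Reachable d.snd w := by
  rw [Dart.mem_side, Sym2.eq_swap (a := d.fst)]; rfl

theorem Dart.mem_side_congr (d : Gr.Dart) {a b : V} (hab : Gr.Adj a b)
    (hne : s(a, b) ≠ s(d.fst, d.snd)) : a ∈ d.side ↔ b ∈ d.side := by
  have h : (Gr.deleteEdges {s(d.fst, d.snd)}).Adj a b := by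
    simpa [deleteEdges_adj, hab] using hne
  rw [Dart.mem_side, Dart.mem_side]
  exact ⟨fun h' => h'.trans h.reachable, fun h' => h'.trans h.reachable.symm⟩

theorem Dart.mem_side_or (hc : Gr.Connected) (d : Gr.Dart) (z : V) :
    z ∈ d.side ∨ z ∈ d.symm.side := by
  obtain ⟨p⟩ := hc d.fst z
  suffices h : ∀ (a b : V) (p : Gr.Walk a b), (a ∈ d.side ∨ a ∈ d.symm.side) →
      (b ∈ d.side ∨ b ∈ d.symm.side) from h _ _ p (Or.inl d.fst_mem_side)
  intro a b p
  induction p with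
  | nil => exact id
  | @cons u v w h p ih =>
    intro hu
    apply ih
    by_cases he : s(u, v) = s(d.fst, d.snd)
    · rcases Sym2.eq_iff.1 he with ⟨h1, h2⟩ | ⟨h1, h2⟩
      · right; rw [h2]; exact d.symm.fst_mem_side
      · left; rw [h2]; exact d.fst_mem_side
    · refine hu.imp (d.mem_side_congr h he).1 (d.symm.mem_side_congr h ?_).1
      intro h'
      exact he (h'.trans Sym2.eq_swap)

theorem Dart.notMem_side_symm (ha : Gr.IsAcyclic) {d : Gr.Dart} {z : V} (hz : z ∈ d.side) :
    z ∉ d.symm.side := by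
  intro h
  rw [Dart.mem_side] at hz
  rw [Dart.mem_side_symm_iff_reachable] at h
  have hb := isAcyclic_iff_forall_adj_isBridge.1 ha d.adj
  exact isBridge_iff.1 hb (hz.trans h.symm)

theorem IsTree.mem_side_symm (hT : Gr.IsTree) {d : Gr.Dart} {z : V} :
    z ∈ d.symm.side ↔ z ∉ d.side :=
  ⟨fun h h' => Dart.notMem_side_symm hT.isAcyclic h' h,
    fun h => (Dart.mem_side_or hT.connected d z).resolve_left h⟩

theorem IsTree.snd_notMem_side (hT : Gr.IsTree) (d : Gr.Dart) : d.snd ∉ d.side :=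
  hT.mem_side_symm.1 d.symm.fst_mem_side

theorem IsTree.exists_dart_of_ne (hT : Gr.IsTree) {x z : V} (h : z ≠ x) :
    ∃ d : Gr.Dart, d.fst = x ∧ z ∈ d.symm.side := by
  obtain ⟨p, hp⟩ := (hT.connected x z).exists_isPath
  cases p with
  | nil => exact absurd rfl h
  | @cons _ w _ hadj p =>
    rw [Walk.cons_isPath_iff] at hp
    refine ⟨⟨(x, w), hadj⟩, rfl, ?_⟩
    rw [Dart.mem_side_symm_iff_reachable, reachable_deleteEdges_iff_exists_walk]
    exact ⟨p, fun he => hp.2 (p.fst_mem_support_of_mem_edges he)⟩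

theorem IsTree.mem_side_iff_snd (hT : Gr.IsTree) {d e : Gr.Dart} (h1 : e ≠ d) (h2 : e ≠ d.symm)
    (he : e.fst ∈ d.side) {z : V} (hz : z ∈ d.symm.side) : z ∈ e.side ↔ d.snd ∈ e.side := by
  have hz' := Dart.mem_side_symm_iff_reachable.1 hz
  obtain ⟨p⟩ := hz'
  suffices h : ∀ (a b : V) (p : (Gr.deleteEdges {s(d.fst, d.snd)}).Walk a b),
      a ∈ d.symm.side → (b ∈ e.side ↔ a ∈ e.side) from h _ _ p d.symm.fst_mem_side
  intro a b p
  induction p with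
  | nil => exact fun _ => Iff.rfl
  | @cons u v w h p ih =>
    intro hu
    have hadj : Gr.Adj u v := (deleteEdges_le _) h
    have hne : s(u, v) ≠ s(d.fst, d.snd) := by
      simpa using (deleteEdges_adj.1 h).2
    have hu' := hT.mem_side_symm.1 hu
    have hv : v ∈ d.symm.side :=
      hT.mem_side_symm.2 fun hv => hu' ((d.mem_side_congr hadj hne).2 hv)
    have hes : e.snd ∈ d.side := (d.mem_side_congr e.adj (Dart.edge_mk_ne h1 h2)).1 he
    rw [ih hv]
    refine (e.mem_side_congr hadj fun h' => ?_).symm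
    rcases Sym2.eq_iff.1 h' with ⟨h1, h2⟩ | ⟨h1, h2⟩
    · exact hu' (h1 ▸ he)
    · exact hu' (h1 ▸ hes)

theorem IsTree.symm_side_ssubset_or (hT : Gr.IsTree) {d e : Gr.Dart} (h1 : e ≠ d)
    (h2 : e ≠ d.symm) (he : e.fst ∈ d.side) :
    d.symm.side ⊂ e.side ∨ d.symm.side ⊂ e.symm.side := by
  have hes : e.snd ∈ d.side := (d.mem_side_congr e.adj (Dart.edge_mk_ne h1 h2)).1 he
  by_cases hd : d.snd ∈ e.side
  · left
    refine (Finset.ssubset_iff_of_subset fun z hz => ?_).2 ⟨e.fst, e.fst_mem_side, ?_⟩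
    · exact (hT.mem_side_iff_snd h1 h2 he hz).2 hd
    · exact fun h => hT.mem_side_symm.1 h he
  · right
    refine (Finset.ssubset_iff_of_subset fun z hz => ?_).2 ⟨e.snd, e.symm.fst_mem_side, ?_⟩
    · exact hT.mem_side_symm.2 fun h => hd ((hT.mem_side_iff_snd h1 h2 he hz).1 h)
    · exact fun h => hT.mem_side_symm.1 h hes

theorem IsTree.side_nested (hT : Gr.IsTree) {d e : Gr.Dart} (h1 : e ≠ d) (h2 : e ≠ d.symm) :
    d.side ⊂ e.side ∨ d.side ⊂ e.symm.side ∨ d.symm.side ⊂ e.side ∨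
      d.symm.side ⊂ e.symm.side := by
  rcases Dart.mem_side_or hT.connected d e.fst with h | h
  · exact Or.inr (Or.inr (hT.symm_side_ssubset_or h1 h2 h))
  · have := hT.symm_side_ssubset_or (d := d.symm) (e := e) h2 (by simpa using h1) h
    rw [Dart.symm_symm] at this
    tauto

theorem IsTree.disjoint_side_symm (hT : Gr.IsTree) {d e : Gr.Dart} (hne : e ≠ d)
    (h : e.fst = d.fst) : Disjoint d.symm.side e.symm.side := by
  rw [Finset.disjoint_left]
  intro z hz hz'
  have h2 : e ≠ d.symm := by
    rintro rfl
    exact d.snd_ne_fst h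
  have he : e.fst ∈ d.side := h ▸ d.fst_mem_side
  refine hT.mem_side_symm.1 hz' ((hT.mem_side_iff_snd hne h2 he hz).2 ?_)
  refine (e.mem_side_congr d.adj (Dart.edge_mk_ne hne.symm ?_)).1 (h ▸ e.fst_mem_side)
  rintro rfl
  exact h2 (by simp)

theorem IsTree.sum_eq_add_sum_darts [DecidableEq V] (hT : Gr.IsTree) {A : Type*}
    [AddCommMonoid A] (f : V → A)
    (x : V) : ∑ z, f z =
      f x + ∑ d ∈ Finset.univ.filter (fun d : Gr.Dart => d.fst = x), ∑ z ∈ d.symm.side, f z := by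
  rw [← Finset.sum_biUnion, ← Finset.sum_insert]
  · refine Finset.sum_congr ?_ fun _ _ => rfl
    ext z
    simp only [Finset.mem_univ, Finset.mem_insert, Finset.mem_biUnion, Finset.mem_filter,
      true_and, true_iff]
    by_cases h : z = x
    · exact Or.inl h
    · exact Or.inr (hT.exists_dart_of_ne h)
  · simp only [Finset.mem_biUnion, Finset.mem_filter, Finset.mem_univ, true_and, not_exists,
      not_and]
    rintro d rfl h
    exact hT.mem_side_symm.1 h d.fst_mem_side
  · intro d hd e he hne
    simp only [Finset.coe_filter, Finset.mem_univ, true_and, Set.mem_ofPred_eq] at hd he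
    exact hT.disjoint_side_symm hne.symm (he.trans hd.symm)

theorem IsTree.sum_side_add_sum_side_symm (hT : Gr.IsTree) {A : Type*} [AddCommMonoid A]
    (f : V → A) (d : Gr.Dart) :
    ∑ z ∈ d.side, f z + ∑ z ∈ d.symm.side, f z = ∑ z, f z := by
  rw [← Finset.sum_union]
  · refine Finset.sum_congr ?_ fun _ _ => rfl
    ext z
    simpa using Dart.mem_side_or hT.connected d z
  · rw [Finset.disjoint_left]
    exact fun z hz => Dart.notMem_side_symm hT.isAcyclic hz

theorem IsTree.side_ssubset_symm (hT : Gr.IsTree) {d e : Gr.Dart} (h : d.side ⊂ e.side) :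
    e.symm.side ⊂ d.symm.side := by
  rw [Finset.ssubset_iff_subset_ne] at h ⊢
  refine ⟨fun z hz => hT.mem_side_symm.2 fun hz' => hT.mem_side_symm.1 hz (h.1 hz'), fun h' => ?_⟩
  apply h.2
  ext z
  have := Finset.ext_iff.1 h' z
  rw [hT.mem_side_symm, hT.mem_side_symm] at this
  tauto

theorem IsTree.fst_notMem_side_of_ssubset (hT : Gr.IsTree) {a d : Gr.Dart}
    (h : a.side ⊂ d.side) : d.fst ∉ a.side := by
  intro hx
  have h1 : a ≠ d := by rintro rfl; exact h.ne rfl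
  have h2 : a ≠ d.symm := by
    rintro rfl
    exact hT.mem_side_symm.1 hx d.fst_mem_side
  have hy := (a.mem_side_congr d.adj (Dart.edge_mk_ne h1.symm fun h' => h2 (by simp [h']))).1 hx
  exact hT.snd_notMem_side d (h.subset hy)

theorem IsTree.exists_dart_between (hT : Gr.IsTree) {a d : Gr.Dart} (h : a.side ⊂ d.side) :
    ∃ e : Gr.Dart, e.snd = d.fst ∧ e ≠ d.symm ∧ (a = e ∨ a.side ⊂ e.side) := by
  have hx := hT.fst_notMem_side_of_ssubset h
  have hne : a.fst ≠ d.fst := fun h' => hx (h' ▸ a.fst_mem_side)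
  obtain ⟨e, he, hae⟩ := hT.exists_dart_of_ne hne
  refine ⟨e.symm, he, ?_, ?_⟩
  · intro h'
    rw [h'] at hae
    exact hT.mem_side_symm.1 hae (h.subset a.fst_mem_side)
  · have hxe : d.fst ∈ e.side := he ▸ e.fst_mem_side
    by_cases h1 : a = e.symm
    · exact Or.inl h1
    right
    have h2 : a ≠ e := by
      rintro rfl
      exact hx hxe
    rcases hT.side_nested (d := a) (e := e.symm) (Ne.symm h1)
      (fun h' => h2 (by simpa using congrArg Dart.symm h'.symm)) with h3 | h3 | h3 | h3
    · exact h3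
    · rw [Dart.symm_symm] at h3
      exact absurd (h3.subset a.fst_mem_side) (hT.mem_side_symm.1 hae)
    · exact absurd hxe (hT.mem_side_symm.1 (h3.subset (hT.mem_side_symm.2 hx)))
    · have h4 := hT.side_ssubset_symm h3
      rw [Dart.symm_symm, Dart.symm_symm] at h4
      have h5 : e.snd ∈ a.side := h4.subset e.symm.fst_mem_side
      refine absurd ((a.mem_side_congr e.adj (Dart.edge_mk_ne h2.symm fun h' => h1 ?_)).2 h5)
        (he ▸ hx)
      rw [h', Dart.symm_symm]

theorem IsTree.side_ssubset_of_snd_eq_fst (hT : Gr.IsTree) {w d : Gr.Dart} (h : w.snd = d.fst)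
    (hne : w ≠ d.symm) : w.side ⊂ d.side := by
  have h1 : d ≠ w.symm := by
    rintro rfl
    exact hne (by simp)
  have hd := hT.disjoint_side_symm (d := w.symm) (e := d) h1 h.symm
  rw [Dart.symm_symm, Finset.disjoint_left] at hd
  refine (Finset.ssubset_iff_of_subset fun z hz => ?_).2 ⟨d.fst, d.fst_mem_side, ?_⟩
  · by_contra h'
    exact hd hz (hT.mem_side_symm.2 h')
  · rw [← h]
    exact hT.snd_notMem_side w

/-- The covering pairs for strict inclusion of sides are the consecutive darts. -/
theorem IsTree.side_covBy_iff (hT : Gr.IsTree) {w d : Gr.Dart} :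
    (w.side ⊂ d.side ∧ ¬ ∃ e : Gr.Dart, w.side ⊂ e.side ∧ e.side ⊂ d.side) ↔
      w.snd = d.fst ∧ w ≠ d.symm := by
  constructor
  · rintro ⟨h, hn⟩
    obtain ⟨e, he, hne, rfl | hwe⟩ := hT.exists_dart_between h
    · exact ⟨he, hne⟩
    · exact absurd ⟨e, hwe, hT.side_ssubset_of_snd_eq_fst he hne⟩ hn
  · rintro ⟨h, hne⟩
    refine ⟨hT.side_ssubset_of_snd_eq_fst h hne, ?_⟩
    rintro ⟨c, hwc, hcd⟩
    have hx := hT.fst_notMem_side_of_ssubset hcd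
    have hw := hwc.subset w.fst_mem_side
    refine hx (h ▸ (c.mem_side_congr w.adj (Dart.edge_mk_ne ?_ ?_)).1 hw)
    · rintro rfl
      exact hwc.ne rfl
    · rintro rfl
      exact Dart.notMem_side_symm hT.isAcyclic (hwc.subset c.symm.fst_mem_side)
        c.symm.fst_mem_side

end SimpleGraph

/-- The complementary part of the same split. -/
def opp {n : ℕ} (u : Fin n × Bool) : Fin n × Bool := (u.1, !u.2)

section Thin

variable {X : Type} {M : Multiset X} {n : ℕ} {P : Fin n → Bool → Multiset X}
  {G : Fin n × Bool → Fin n × Bool → Prop}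

@[simp] theorem opp_opp {u : Fin n × Bool} : opp (opp u) = u := by simp [opp]

@[simp] theorem opp_fst (u : Fin n × Bool) : (opp u).1 = u.1 := rfl

@[simp] theorem opp_snd (u : Fin n × Bool) : (opp u).2 = !u.2 := rfl

theorem opp_ne (u : Fin n × Bool) : opp u ≠ u := fun h => by
  simpa using congrArg Prod.snd h

theorem eq_or_eq_opp {u v : Fin n × Bool} (h : u.1 = v.1) : u = v ∨ u = opp v := by
  obtain ⟨i, b⟩ := u
  obtain ⟨j, c⟩ := v
  obtain rfl : i = j := h
  cases b <;> cases c <;> simp [opp]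

theorem part_add_part_opp (hsum : ∀ i, P i true + P i false = M) (u : Fin n × Bool) :
    P u.1 u.2 + P (opp u).1 (opp u).2 = M := by
  obtain ⟨i, b⟩ := u
  cases b
  · simpa [opp, add_comm] using hsum i
  · simpa [opp] using hsum i

namespace IsThinSubgraph

theorem card_lt (h : IsThinSubgraph P G) {u v : Fin n × Bool} (huv : G u v) :
    (P u.1 u.2).card < (P v.1 v.2).card :=
  Multiset.card_lt_card (h.1 u v huv).2

theorem opp_arc (h : IsThinSubgraph P G) {u v : Fin n × Bool} (huv : G u v) :
    G (opp v) (opp u) := by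
  obtain ⟨b, c, hbc⟩ := h.2 u.1 v.1 (h.1 u v huv).1
  obtain ⟨h1, h2⟩ := ((hbc u.2 v.2).1).1 huv
  exact ((hbc (!u.2) (!v.2)).2).2 (by simp [h1, h2])

theorem opp_arc_iff (h : IsThinSubgraph P G) {u v : Fin n × Bool} :
    G (opp v) (opp u) ↔ G u v :=
  ⟨fun h' => by simpa using h.opp_arc h', h.opp_arc⟩

theorem eq_of_arc (h : IsThinSubgraph P G) {i j : Fin n} {b b' c c' : Bool}
    (h1 : G (i, b) (j, c)) (h2 : G (i, b') (j, c')) : b = b' ∧ c = c' := by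
  obtain ⟨b₀, c₀, hbc⟩ := h.2 i j (h.1 _ _ h1).1
  have h3 := ((hbc b c).1).1 h1
  have h4 := ((hbc b' c').1).1 h2
  simp [h3, h4]

theorem exists_arc (h : IsThinSubgraph P G) {i j : Fin n} (hij : i ≠ j) :
    ∃ b c, G (i, b) (j, c) := by
  obtain ⟨b, c, hbc⟩ := h.2 i j hij
  exact ⟨b, c, ((hbc b c).1).2 ⟨rfl, rfl⟩⟩

theorem transGen_card_lt (h : IsThinSubgraph P G) {u v : Fin n × Bool}
    (huv : Relation.TransGen G u v) : (P u.1 u.2).card < (P v.1 v.2).card := by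
  induction huv with
  | single h' => exact h.card_lt h'
  | tail _ h' ih => exact ih.trans (h.card_lt h')

theorem part_le_of_reflTransGen (h : IsThinSubgraph P G) {u v : Fin n × Bool}
    (huv : Relation.ReflTransGen G u v) : P u.1 u.2 ≤ P v.1 v.2 := by
  induction huv with
  | refl => exact le_rfl
  | tail _ h' ih => exact ih.trans (h.1 _ _ h').2.le

theorem opp_transGen (h : IsThinSubgraph P G) {u v : Fin n × Bool}
    (huv : Relation.TransGen G u v) : Relation.TransGen G (opp v) (opp u) := by
  induction huv with
  | single h' => exact .single (h.opp_arc h')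
  | tail _ h' ih => exact .head (h.opp_arc h') ih

theorem opp_reflTransGen (h : IsThinSubgraph P G) {u v : Fin n × Bool}
    (huv : Relation.ReflTransGen G u v) : Relation.ReflTransGen G (opp v) (opp u) := by
  induction huv with
  | refl => exact .refl
  | tail _ h' ih => exact .head (h.opp_arc h') ih

theorem opp_isCriticalArc (h : IsThinSubgraph P G) {u v : Fin n × Bool}
    (huv : IsCriticalArc G u v) : IsCriticalArc G (opp v) (opp u) := by
  refine ⟨h.opp_arc huv.1, ?_⟩
  rintro ⟨w, h1, -, h3⟩
  have h1' := h.opp_arc h1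
  have h3' := h.opp_transGen h3
  simp only [opp_opp] at h1' h3'
  obtain ⟨z, hz, hzw⟩ := Relation.TransGen.head'_iff.1 h3'
  have hzv : Relation.TransGen G z v := .tail' hzw h1'
  refine huv.2 ⟨z, hz, ?_, hzv⟩
  rintro rfl
  exact (h.transGen_card_lt hzv).false

theorem exists_isCriticalArc (h : IsThinSubgraph P G) {v w : Fin n × Bool}
    (hvw : Relation.TransGen G v w) :
    ∃ z, Relation.ReflTransGen G v z ∧ IsCriticalArc G z w := by
  obtain ⟨y, hy⟩ := Relation.TransGen.tail'_iff.1 hvw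
  obtain ⟨z, hz, hmax⟩ := Finset.exists_max_image
    (Finset.univ.filter fun z => Relation.ReflTransGen G v z ∧ G z w)
    (fun z => (P z.1 z.2).card) ⟨y, by simpa using hy⟩
  simp only [Finset.mem_filter, Finset.mem_univ, true_and] at hz hmax
  refine ⟨z, hz.1, hz.2, ?_⟩
  rintro ⟨c, hzc, -, hcw⟩
  obtain ⟨z', hcz', hz'w⟩ := Relation.TransGen.tail'_iff.1 hcw
  have h1 := hmax z' ⟨(hz.1.tail hzc).trans hcz', hz'w⟩
  have h2 := Multiset.card_le_card (h.part_le_of_reflTransGen hcz')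
  have h3 := h.card_lt hzc
  omega

end IsThinSubgraph

theorem IsConsistent.add_le (hcon : IsConsistent P G) {x y w : Fin n × Bool}
    (hx : IsCriticalArc G x w) (hy : IsCriticalArc G y w) (hxy : x ≠ y) :
    P x.1 x.2 + P y.1 y.2 ≤ P w.1 w.2 := by
  refine le_trans ?_ (hcon w)
  rw [← Finset.sum_pair (f := fun z => P z.1 z.2) hxy]
  refine Finset.sum_le_sum_of_subset ?_
  intro z
  simp only [Finset.mem_insert, Finset.mem_singleton, Finset.mem_filter, Finset.mem_univ, true_and]
  rintro (rfl | rfl) <;> assumption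

theorem card_part_add_card_part_opp (hsum : ∀ i, P i true + P i false = M)
    (u : Fin n × Bool) :
    (P u.1 u.2).card + (P (opp u).1 (opp u).2).card = M.card := by
  rw [← Multiset.card_add, part_add_part_opp hsum]

theorem card_part_pos (hne : ∀ i b, P i b ≠ 0) (u : Fin n × Bool) : 0 < (P u.1 u.2).card :=
  Multiset.card_pos.2 (hne _ _)

namespace IsThinSubgraph

theorem not_transGen_opp (h : IsThinSubgraph P G) (hne : ∀ i b, P i b ≠ 0)
    (hsum : ∀ i, P i true + P i false = M) (hcon : IsConsistent P G)
    (u : Fin n × Bool) : ¬ Relation.TransGen G u (opp u) := by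
  induction hk : M.card - (P u.1 u.2).card using Nat.strong_induction_on generalizing u with
  | _ k ih =>
  intro hu
  obtain ⟨x, hux, hx⟩ := h.exists_isCriticalArc hu
  have hxu := h.opp_isCriticalArc hx
  rw [opp_opp] at hxu
  rcases Relation.reflTransGen_iff_eq_or_transGen.1 hux with rfl | hux'
  · exact (h.1 _ _ hx.1).1 rfl
  have hux'' := h.opp_transGen hux'
  obtain ⟨y, hxy, hy⟩ := h.exists_isCriticalArc hux''
  have hyx := h.opp_reflTransGen hxy
  have hc := card_part_add_card_part_opp hsum
  have h0 := card_part_pos hne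
  by_cases hxy' : x = y
  · subst hxy'
    rw [opp_opp] at hyx
    have hux1 := h.transGen_card_lt hux'
    have hlt : (P u.1 u.2).card < (P (opp x).1 (opp x).2).card := h.card_lt hxu.1
    rcases Relation.reflTransGen_iff_eq_or_transGen.1 hyx with h' | h'
    · exact opp_ne x h'.symm
    · refine ih _ ?_ (opp x) rfl (by simpa using h')
      have := hc (opp x)
      have := h0 (opp x)
      omega
  · have h1 := Multiset.card_le_card (hcon.add_le hx hy hxy')
    rw [Multiset.card_add] at h1
    have h2 := Multiset.card_le_card (h.part_le_of_reflTransGen hxy)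
    have := hc x
    have := hc u
    have := h0 u
    omega

theorem not_reflTransGen_both (h : IsThinSubgraph P G) (hne : ∀ i b, P i b ≠ 0)
    (hsum : ∀ i, P i true + P i false = M) (hcon : IsConsistent P G)
    {u v w : Fin n × Bool} (huv : G u v) (hv : Relation.ReflTransGen G v w)
    (hu : Relation.ReflTransGen G (opp u) w) : False := by
  have hN := h.not_transGen_opp hne hsum hcon
  induction hk : (P w.1 w.2).card using Nat.strong_induction_on generalizing w with
  | _ k ih =>
  rcases Relation.reflTransGen_iff_eq_or_transGen.1 hv with rfl | hv'
  · refine hN (opp w) (.trans_left (.single (h.opp_arc huv)) (by simpa using hu))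
  rcases Relation.reflTransGen_iff_eq_or_transGen.1 hu with rfl | hu'
  · exact hN u (.head' huv hv)
  obtain ⟨x, hvx, hx⟩ := h.exists_isCriticalArc hv'
  obtain ⟨y, huy, hy⟩ := h.exists_isCriticalArc hu'
  by_cases hxy : x = y
  · subst hxy
    exact ih _ (hk ▸ h.card_lt hx.1) hvx huy rfl
  · have h1 := Multiset.card_le_card (hcon.add_le hx hy hxy)
    rw [Multiset.card_add] at h1
    have h2 := Multiset.card_le_card (h.part_le_of_reflTransGen hvx)
    have h3 := Multiset.card_le_card (h.part_le_of_reflTransGen huy)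
    have h4 := h.card_lt huv
    have := card_part_add_card_part_opp hsum u
    have := card_part_add_card_part_opp hsum w
    omega

theorem trans (h : IsThinSubgraph P G) (hne : ∀ i b, P i b ≠ 0)
    (hsum : ∀ i, P i true + P i false = M) (hcon : IsConsistent P G)
    {u v w : Fin n × Bool} (huv : G u v) (hvw : G v w) : G u w := by
  have hN := h.not_transGen_opp hne hsum hcon
  have h1 := h.card_lt huv
  have h2 := h.card_lt hvw
  have hne' : u.1 ≠ w.1 := by
    intro h'
    rcases eq_or_eq_opp h' with rfl | rfl
    · omega
    · exact hN (opp w) (by simpa using Relation.TransGen.tail (.single huv) hvw)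
  obtain ⟨b, c, hbc⟩ := h.exists_arc hne'
  have hu : (u.1, b) = u ∨ (u.1, b) = opp u := eq_or_eq_opp rfl
  have hw : (w.1, c) = w ∨ (w.1, c) = opp w := eq_or_eq_opp rfl
  rcases hu with hu | hu <;> rcases hw with hw | hw <;> rw [hu, hw] at hbc
  · exact hbc
  · have h3 := h.opp_arc hbc
    rw [opp_opp] at h3
    exact (hN u (.tail (.tail (.single huv) hvw) h3)).elim
  · exact (h.not_reflTransGen_both hne hsum hcon huv (.single hvw) (.single hbc)).elim
  · have h3 := h.card_lt (h.opp_arc_iff.1 hbc)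
    omega

end IsThinSubgraph

end Thin

theorem exists_equiv_of_map_univ_eq {α β γ : Type*} [Fintype α] [Fintype β] {f : α → γ}
    {g : β → γ} (h : (Finset.univ.val : Multiset α).map f = (Finset.univ.val : Multiset β).map g) :
    ∃ e : α ≃ β, ∀ a, g (e a) = f a := by
  have hc : ∀ c, Nonempty ({a // f a = c} ≃ {b // g b = c}) := by
    intro c
    have h1 := congrArg (Multiset.count c) h
    rw [Multiset.count_map, Multiset.count_map] at h1
    refine Fintype.card_eq.1 ?_
    rw [Fintype.card_subtype, Fintype.card_subtype]
    simpa only [Finset.card_def, Finset.filter_val, eq_comm] using h1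
  exact ⟨Equiv.ofFiberEquiv fun c => (hc c).some, fun a => Equiv.ofFiberEquiv_map _ a⟩

/-- An enumeration of the darts of a graph by the vertices of `Γ(𝔖)` which turns complements
into reversals and the arcs of `G` into strict inclusions of sides. -/
structure IsDartCoding {V : Type} [Fintype V] {n : ℕ} (Gr : SimpleGraph V)
    (G : Fin n × Bool → Fin n × Bool → Prop) (δ : Fin n × Bool ≃ Gr.Dart) : Prop where
  opp : ∀ u, δ (opp u) = (δ u).symm
  arc : ∀ u v, G u v ↔ (δ u).side ⊂ (δ v).side

namespace IsDartCoding

variable {V : Type} [Fintype V] {n : ℕ} {Gr : SimpleGraph V}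
  {G : Fin n × Bool → Fin n × Bool → Prop} {δ : Fin n × Bool ≃ Gr.Dart}

theorem isCriticalArc_iff (h : IsDartCoding Gr G δ) (hT : Gr.IsTree) {u v : Fin n × Bool} :
    IsCriticalArc G u v ↔ (δ u).snd = (δ v).fst ∧ δ u ≠ (δ v).symm := by
  have htrans : ∀ {x y}, Relation.TransGen G x y → G x y := by
    intro x y hxy
    induction hxy with
    | single h' => exact h'
    | tail _ h' ih => exact (h.arc _ _).2 (((h.arc _ _).1 ih).trans ((h.arc _ _).1 h'))
  rw [← hT.side_covBy_iff, IsCriticalArc, h.arc]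
  refine and_congr_right fun _ => not_congr ⟨?_, ?_⟩
  · rintro ⟨w, h1, -, h3⟩
    exact ⟨δ w, (h.arc _ _).1 h1, (h.arc _ _).1 (htrans h3)⟩
  · rintro ⟨e, h1, h2⟩
    refine ⟨δ.symm e, (h.arc _ _).2 (by simpa using h1), ?_, .single ((h.arc _ _).2
      (by simpa using h2))⟩
    rintro rfl
    simp at h2

theorem sum_isCriticalArc [DecidableEq V] (h : IsDartCoding Gr G δ) (hT : Gr.IsTree) {A : Type*}
    [AddCommMonoid A] (F : Fin n × Bool → A) (u : Fin n × Bool) :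
    ∑ w ∈ Finset.univ.filter (fun w => IsCriticalArc G w u), F w =
      ∑ e ∈ (Finset.univ.filter (fun e : Gr.Dart => e.fst = (δ u).fst)).erase (δ u),
        F (δ.symm e.symm) := by
  refine Finset.sum_nbij' (fun w => (δ w).symm) (fun e => δ.symm e.symm) ?_ ?_ ?_ ?_ ?_
  · intro w hw
    obtain ⟨h1, h2⟩ := (h.isCriticalArc_iff hT).1 (Finset.mem_filter.1 hw).2
    simp only [Finset.mem_erase, Finset.mem_filter, Finset.mem_univ, true_and]
    refine ⟨fun h' => h2 ?_, h1⟩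
    rw [← h', SimpleGraph.Dart.symm_symm]
  · intro e he
    simp only [Finset.mem_erase, Finset.mem_filter, Finset.mem_univ, true_and] at he ⊢
    rw [h.isCriticalArc_iff hT, Equiv.apply_symm_apply]
    exact ⟨he.2, fun h' => he.1 (SimpleGraph.Dart.symm_involutive.injective h')⟩
  · simp
  · simp
  · simp

end IsDartCoding

theorem isThinSubgraph_of_sides {V X : Type} [Fintype V] {n : ℕ}
    {P : Fin n → Bool → Multiset X} {G : Fin n × Bool → Fin n × Bool → Prop}
    (H : Fin n × Bool → Finset V) (hG : ∀ u v, G u v ↔ H u ⊂ H v)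
    (hopp : ∀ u z, z ∈ H (opp u) ↔ z ∉ H u)
    (hne : ∀ u, (H u).Nonempty) (hP : ∀ u v, H u ⊂ H v → P u.1 u.2 < P v.1 v.2)
    (hex : ∀ u v : Fin n × Bool, u.1 ≠ v.1 →
      H u ⊂ H v ∨ H u ⊂ H (opp v) ∨ H (opp u) ⊂ H v ∨ H (opp u) ⊂ H (opp v)) :
    IsThinSubgraph P G := by
  have hnss : ∀ u v : Fin n × Bool, u.1 = v.1 → ¬ H u ⊂ H v := by
    intro u v huv h
    rcases eq_or_eq_opp huv with rfl | rfl
    · exact h.ne rfl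
    · obtain ⟨z, hz⟩ := hne (opp v)
      exact (hopp _ _).1 hz (h.subset hz)
  refine ⟨fun u v h => ⟨fun huv => hnss u v huv ((hG u v).1 h), hP u v ((hG u v).1 h)⟩, ?_⟩
  have key : ∀ (i j : Fin n) (b c : Bool), H (i, b) ⊂ H (j, c) → ∀ b' c' : Bool,
      (G (i, b') (j, c') ↔ b' = b ∧ c' = c) ∧ (G (j, c') (i, b') ↔ c' = !c ∧ b' = !b) := by
    intro i j b c h
    obtain ⟨x, hx⟩ := hne (i, b)
    obtain ⟨y, hy⟩ := hne (opp (j, c))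
    obtain ⟨w, hw, hw'⟩ := Finset.exists_of_ssubset h
    have hx' := h.subset hx
    have hy1 := (hopp _ _).1 hy
    have hy' : y ∉ H (i, b) := fun h' => hy1 (h.subset h')
    have hi := hopp (i, b)
    have hj := hopp (j, c)
    have h' : H (j, !c) ⊂ H (i, !b) := by
      refine (Finset.ssubset_iff_of_subset fun z hz => (hi z).2 fun h' => ?_).2
        ⟨w, (hi w).2 hw', fun h' => (hj w).1 h' hw⟩
      exact (hj z).1 hz (h.subset h')
    simp only [opp] at hi hj hy
    intro b' c'
    rw [hG, hG]
    have hb : b' = b ∨ b' = !b := by cases b <;> cases b' <;> simp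
    have hc : c' = c ∨ c' = !c := by cases c <;> cases c' <;> simp
    rcases hb with rfl | rfl <;> rcases hc with rfl | rfl
    · simp only [and_self, iff_true]
      exact ⟨h, by simpa using fun h' => hw' (h'.subset hw)⟩
    · simp
      exact ⟨fun h' => (hj x).1 (h'.subset hx) hx', fun h' => hy' (h'.subset hy)⟩
    · simp
      exact ⟨fun h' => hy1 (h'.subset ((hi y).2 hy')),
        fun h' => (hi x).1 (h'.subset hx') hx⟩
    · simp
      refine ⟨fun h'' => ?_, h'⟩
      exact (hj w).1 (h''.subset ((hi w).2 hw')) hw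
  intro i j hij
  rcases hex (i, true) (j, true) hij with h | h | h | h
  · exact ⟨_, _, key _ _ _ _ h⟩
  · exact ⟨_, _, key _ _ _ _ h⟩
  · exact ⟨_, _, key _ _ _ _ h⟩
  · exact ⟨_, _, key _ _ _ _ h⟩

namespace MTree

variable {X : Type} {M : Multiset X}

theorem isTree (T : MTree X M) : T.G.IsTree := ⟨T.connected, T.acyclic⟩

theorem part_eq_sum_side (T : MTree X M) (d : T.G.Dart) :
    T.part d.fst d.snd = ∑ z ∈ d.side, T.label z :=
  Finset.sum_congr (by ext; simp [SimpleGraph.Dart.mem_side]) fun _ _ => rfl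

theorem part_symm_eq_sum_side (T : MTree X M) (d : T.G.Dart) :
    T.part d.snd d.fst = ∑ z ∈ d.symm.side, T.label z :=
  T.part_eq_sum_side d.symm

theorem part_add_part_symm (T : MTree X M) (d : T.G.Dart) :
    T.part d.fst d.snd + T.part d.snd d.fst = M := by
  rw [part_eq_sum_side, part_symm_eq_sum_side, T.isTree.sum_side_add_sum_side_symm, T.m1]

theorem label_add_sum_part (T : MTree X M) (x : Fin T.n) :
    T.label x + ∑ e ∈ Finset.univ.filter (fun e : T.G.Dart => e.fst = x), T.part e.snd e.fst =
      M := by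
  refine Eq.trans ?_ ((T.isTree.sum_eq_add_sum_darts T.label x).symm.trans T.m1)
  exact congrArg _ (Finset.sum_congr rfl fun e _ => T.part_symm_eq_sum_side e)

theorem label_add_sum_part_erase (T : MTree X M) (d : T.G.Dart) :
    T.label d.fst + ∑ e ∈ (Finset.univ.filter (fun e : T.G.Dart => e.fst = d.fst)).erase d,
      T.part e.snd e.fst = T.part d.fst d.snd := by
  have h1 := T.label_add_sum_part d.fst
  rw [← Finset.sum_erase_add (a := d) _ _ (by simp), ← add_assoc] at h1
  exact add_right_cancel (h1.trans (T.part_add_part_symm d).symm)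

theorem part_lt_part (T : MTree X M) (hne : ∀ d : T.G.Dart, T.part d.fst d.snd ≠ 0)
    {a d : T.G.Dart} (h : a.side ⊂ d.side) : T.part a.fst a.snd < T.part d.fst d.snd := by
  obtain ⟨e, he, hed, hae⟩ := T.isTree.exists_dart_between h
  have h1 : T.part a.fst a.snd ≤ T.part e.fst e.snd := by
    rcases hae with rfl | hae
    · exact le_rfl
    · rw [part_eq_sum_side, part_eq_sum_side]
      exact Finset.sum_le_sum_of_subset hae.subset
  refine h1.trans_lt ?_
  have hed' : e.symm ≠ d := by
    rintro rfl
    simp at hed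
  have hmem : e.symm ∈ (Finset.univ.filter (fun e : T.G.Dart => e.fst = d.fst)).erase d := by
    simpa [hed'] using he
  rw [← T.label_add_sum_part_erase d, ← Finset.sum_erase_add _ _ hmem, ← add_assoc]
  refine lt_add_of_pos_left _ (pos_iff_ne_zero.2 fun h0 => ?_)
  rw [add_eq_zero, Finset.sum_eq_zero_iff] at h0
  have hS : ((Finset.univ.filter (fun e : T.G.Dart => e.fst = d.fst)).erase d).erase e.symm
      = ∅ := by
    rw [Finset.eq_empty_iff_forall_notMem]
    exact fun c hc => hne c.symm (h0.2 c hc)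
  refine T.m2 d.fst (Or.inr ?_) h0.1
  rw [← SimpleGraph.dart_fst_fiber_card_eq_degree]
  have h3 := congrArg Finset.card hS
  rw [Finset.card_empty, Finset.card_erase_of_mem hmem, Finset.card_erase_of_mem (by simp)] at h3
  have h4 := Finset.card_pos.2 ⟨_, hmem⟩
  rw [Finset.card_erase_of_mem (by simp)] at h4
  convert (by omega : (Finset.univ.filter (fun e : T.G.Dart => e.fst = d.fst)).card = 2)

/-- A dart coding of an `M`-tree respecting the parts of the splits. -/
structure IsCoding {n : ℕ} (T : MTree X M) (P : Fin n → Bool → Multiset X)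
    (G : Fin n × Bool → Fin n × Bool → Prop) (δ : Fin n × Bool ≃ T.G.Dart) : Prop extends
    IsDartCoding T.G G δ where
  part : ∀ u, T.part (δ u).fst (δ u).snd = P u.1 u.2

theorem IsCoding.part_symm {n : ℕ} {T : MTree X M} {P : Fin n → Bool → Multiset X}
    {G : Fin n × Bool → Fin n × Bool → Prop} {δ : Fin n × Bool ≃ T.G.Dart}
    (h : T.IsCoding P G δ) (e : T.G.Dart) :
    T.part e.fst e.snd = P (δ.symm e).1 (δ.symm e).2 := by
  rw [← h.part, Equiv.apply_symm_apply]

theorem splits_eq_map_univ {n : ℕ} (T : MTree X M) {P : Fin n → Bool → Multiset X}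
    (δ : Fin n × Bool ≃ T.G.Dart) (hopp : ∀ u, δ (opp u) = (δ u).symm)
    (hpart : ∀ u, T.part (δ u).fst (δ u).snd = P u.1 u.2) : T.splits = splitSystemOf P := by
  have hinj : Function.Injective fun i => (δ (i, true)).edge := by
    intro i j hij
    rcases (SimpleGraph.dart_edge_eq_iff _ _).1 hij with h | h
    · exact congrArg Prod.fst (δ.injective h)
    · rw [← hopp] at h
      exact congrArg Prod.fst (δ.injective h)
  have hE : T.G.edgeFinset = Finset.univ.map ⟨_, hinj⟩ := by
    ext e
    simp only [SimpleGraph.mem_edgeFinset, Finset.mem_map, Finset.mem_univ, true_and,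
      Function.Embedding.coeFn_mk]
    constructor
    · intro he
      induction e with
      | _ x y =>
      obtain ⟨u, hu⟩ := δ.surjective ⟨(x, y), he⟩
      refine ⟨u.1, ?_⟩
      have hu' : (δ u).edge = s(x, y) := by rw [hu]; rfl
      rcases eq_or_eq_opp (u := (u.1, true)) (v := u) rfl with h | h
      · rw [h, hu']
      · rw [h, hopp, SimpleGraph.Dart.edge_symm, hu']
    · rintro ⟨i, rfl⟩
      exact SimpleGraph.Dart.edge_mem _
  rw [splits, hE, Finset.map_val, Multiset.map_map, splitSystemOf]
  refine Multiset.map_congr rfl fun i _ => ?_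
  have h1 := hpart (i, true)
  have h2 := hpart (i, false)
  have h3 : δ (i, false) = (δ (i, true)).symm := hopp (i, true)
  rw [h3] at h2
  change s(T.part (δ (i, true)).fst (δ (i, true)).snd,
    T.part (δ (i, true)).symm.fst (δ (i, true)).symm.snd) = _
  rw [h1, h2]

theorem exists_darts_of_splits {n : ℕ} (T : MTree X M) {P : Fin n → Bool → Multiset X}
    (h : T.splits = splitSystemOf P) :
    ∃ δ : Fin n × Bool ≃ T.G.Dart, (∀ u, δ (opp u) = (δ u).symm) ∧
      ∀ u, T.part (δ u).fst (δ u).snd = P u.1 u.2 := by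
  have h' : (Finset.univ.val : Multiset (Fin n)).map (fun i => s(P i true, P i false)) =
      (Finset.univ.val : Multiset T.G.edgeFinset).map (fun e =>
        (Sym2.lift ⟨fun u v => s(T.part u v, T.part v u), fun u v => Sym2.eq_swap⟩) e.1) := by
    rw [← splitSystemOf, ← h, splits]
    have := T.G.edgeFinset.attach_val
    conv_lhs => rw [← Multiset.attach_map_val T.G.edgeFinset.val, Multiset.map_map]
    rfl
  obtain ⟨e, he⟩ := exists_equiv_of_map_univ_eq h'
  have hd : ∀ i, ∃ d : T.G.Dart, d.edge = (e i).1 ∧ T.part d.fst d.snd = P i true ∧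
      T.part d.snd d.fst = P i false := by
    intro i
    have hi := he i
    obtain ⟨⟨s, hs⟩, hes⟩ : ∃ a, a = e i := ⟨_, rfl⟩
    rw [← hes] at hi ⊢
    induction s with
    | _ x y =>
    have hadj : T.G.Adj x y := by simpa using hs
    rcases Sym2.eq_iff.1 hi with ⟨h1, h2⟩ | ⟨h1, h2⟩
    · exact ⟨⟨(x, y), hadj⟩, rfl, h1, h2⟩
    · exact ⟨⟨(y, x), hadj.symm⟩, Sym2.eq_swap, h2, h1⟩
  choose d hde hd1 hd2 using hd
  let F : Fin n × Bool → T.G.Dart := fun u => if u.2 then d u.1 else (d u.1).symm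
  have hFedge : ∀ u, (F u).edge = (e u.1).1 := by
    rintro ⟨i, b⟩
    cases b <;> simp [F, hde]
  have hFopp : ∀ u, F (opp u) = (F u).symm := by
    rintro ⟨i, b⟩
    cases b <;> simp [F, opp]
  have hF : Function.Bijective F := by
    constructor
    · intro u v huv
      have h1 := congrArg SimpleGraph.Dart.edge huv
      rw [hFedge, hFedge] at h1
      rcases eq_or_eq_opp (e.injective (Subtype.ext h1)) with h2 | h2
      · exact h2
      · rw [h2, hFopp] at huv
        exact absurd huv (SimpleGraph.Dart.symm_ne _)
    · intro c
      obtain ⟨i, hi⟩ := e.surjective ⟨c.edge, by simp⟩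
      have h1 : (F (i, true)).edge = c.edge := by rw [hFedge, hi]
      rcases (SimpleGraph.dart_edge_eq_iff _ _).1 h1 with h2 | h2
      · exact ⟨_, h2⟩
      · exact ⟨opp (i, true), by rw [hFopp, h2, SimpleGraph.Dart.symm_symm]⟩
  refine ⟨Equiv.ofBijective F hF, hFopp, ?_⟩
  rintro ⟨i, b⟩
  cases b
  · exact hd2 i
  · exact hd1 i

theorem exists_isCoding {n : ℕ} (T : MTree X M) {P : Fin n → Bool → Multiset X}
    (hne : ∀ i b, P i b ≠ 0) (h : T.splits = splitSystemOf P) :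
    ∃ G, (IsThinSubgraph P G ∧ IsConsistent P G) ∧ ∃ δ, T.IsCoding P G δ := by
  obtain ⟨δ, hopp, hpart⟩ := T.exists_darts_of_splits h
  have hδ : T.IsCoding P (fun u v => (δ u).side ⊂ (δ v).side) δ :=
    ⟨⟨hopp, fun _ _ => Iff.rfl⟩, hpart⟩
  have hT := T.isTree
  refine ⟨fun u v => (δ u).side ⊂ (δ v).side, ⟨?_, ?_⟩, δ, hδ⟩
  · refine isThinSubgraph_of_sides (fun u => (δ u).side) (fun _ _ => Iff.rfl) ?_ ?_ ?_ ?_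
    · intro u z
      rw [hopp, hT.mem_side_symm]
    · exact fun u => ⟨_, (δ u).fst_mem_side⟩
    · intro u v huv
      rw [← hpart, ← hpart]
      refine T.part_lt_part (fun d => ?_) huv
      rw [hδ.part_symm]
      exact hne _ _
    · intro u v huv
      simp only [hopp]
      refine hT.side_nested ?_ ?_
      · exact fun h' => huv (congrArg Prod.fst (δ.injective h')).symm
      · rw [← hopp]
        exact fun h' => huv (congrArg Prod.fst (δ.injective h')).symm
  · intro u
    rw [hδ.sum_isCriticalArc hT, ← hpart, ← T.label_add_sum_part_erase]
    refine le_trans (le_of_eq (Finset.sum_congr rfl fun e _ => ?_)) le_add_self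
    rw [← hδ.part_symm]
    rfl

end MTree

namespace MTree

variable {X : Type} {M : Multiset X} {n : ℕ} {P : Fin n → Bool → Multiset X}
  {T T' : MTree X M} {G G' : Fin n × Bool → Fin n × Bool → Prop}
  {δ : Fin n × Bool ≃ T.G.Dart} {δ' : Fin n × Bool ≃ T'.G.Dart}

theorem IsCoding.subgraphIso (h : T.IsCoding P G δ) (h' : T'.IsCoding P G' δ')
    (hiso : MTreeIso T T') : SubgraphIso P G G' := by
  obtain ⟨φ, hadj, hlab⟩ := hiso
  let θ : T.G.Dart ≃ T'.G.Dart :=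
    { toFun := fun d => ⟨(φ d.fst, φ d.snd), (hadj _ _).1 d.adj⟩
      invFun := fun d => ⟨(φ.symm d.fst, φ.symm d.snd), by
        rw [hadj, Equiv.apply_symm_apply, Equiv.apply_symm_apply]; exact d.adj⟩
      left_inv := fun d => by ext <;> simp
      right_inv := fun d => by ext <;> simp }
  have hside : ∀ d, (θ d).side = d.side.map φ.toEmbedding := by
    intro d
    let ψ : T.G.deleteEdges {s(d.fst, d.snd)} ≃g T'.G.deleteEdges {s(φ d.fst, φ d.snd)} :=
      { toEquiv := φ
        map_rel_iff' := by
          intro a b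
          rw [SimpleGraph.deleteEdges_adj, SimpleGraph.deleteEdges_adj, ← hadj,
            Set.mem_singleton_iff, Set.mem_singleton_iff]
          simp only [Sym2.eq_iff, φ.injective.eq_iff] }
    ext z
    rw [Finset.mem_map_equiv, SimpleGraph.Dart.mem_side, SimpleGraph.Dart.mem_side]
    have := ψ.reachable_iff (u := d.fst) (v := φ.symm z)
    rw [← this]
    simp [ψ, θ]
  refine ⟨δ.trans (θ.trans δ'.symm), ?_, ?_⟩
  · intro u v
    rw [h.arc, h'.arc]
    simp only [Equiv.trans_apply, Equiv.apply_symm_apply, hside]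
    exact Finset.map_ssubset_map.symm
  · intro u
    simp only [Equiv.trans_apply]
    rw [← h'.part_symm, ← h.part u, part_eq_sum_side, part_eq_sum_side, hside, Finset.sum_map]
    exact Finset.sum_congr rfl fun z _ => hlab z

theorem exists_dart_fst [Nonempty T.G.Dart] (x : Fin T.n) : ∃ d : T.G.Dart, d.fst = x := by
  obtain ⟨d⟩ := ‹Nonempty T.G.Dart›
  by_cases hx : d.fst = x
  · exact ⟨d, hx⟩
  · obtain ⟨e, he, -⟩ := T.isTree.exists_dart_of_ne hx
    exact ⟨e, he⟩

theorem subsingleton_of_isEmpty_dart [IsEmpty T.G.Dart] (x y : Fin T.n) : x = y := by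
  by_contra h
  obtain ⟨e, -⟩ := T.isTree.exists_dart_of_ne h
  exact isEmptyElim e

theorem IsCoding.map_opp (hsum : ∀ i, P i true + P i false = M) (hthin : IsThinSubgraph P G)
    (hthin' : IsThinSubgraph P G') {ψ : Fin n × Bool ≃ Fin n × Bool}
    (hψ : ∀ u v, G u v ↔ G' (ψ u) (ψ v)) (hP : ∀ u, P (ψ u).1 (ψ u).2 = P u.1 u.2)
    (u : Fin n × Bool) : ψ (opp u) = opp (ψ u) := by
  have hcard : (P (ψ (opp u)).1 (ψ (opp u)).2) = (P (opp (ψ u)).1 (opp (ψ u)).2) := by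
    have h1 := part_add_part_opp hsum u
    have h2 := part_add_part_opp hsum (ψ u)
    rw [hP] at h2 ⊢
    exact add_left_cancel (h1.trans h2.symm)
  by_cases hfst : (ψ (opp u)).1 = (ψ u).1
  · rcases eq_or_eq_opp hfst with h | h
    · exact absurd (ψ.injective h) (opp_ne u)
    · exact h
  exfalso
  obtain ⟨b, c, hbc⟩ := hthin'.exists_arc hfst
  have hu : ((ψ (opp u)).1, b) = ψ (opp u) ∨ ((ψ (opp u)).1, b) = opp (ψ (opp u)) :=
    eq_or_eq_opp rfl
  have hw : ((ψ u).1, c) = ψ u ∨ ((ψ u).1, c) = opp (ψ u) := eq_or_eq_opp rfl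
  have hloop : ∀ x y, x.1 = y.1 → ¬ G' (ψ x) (ψ y) := fun x y hxy h =>
    (hthin.1 _ _ ((hψ _ _).2 h)).1 hxy
  rcases hu with hu | hu <;> rcases hw with hw | hw <;> rw [hu, hw] at hbc
  · exact hloop (opp u) u rfl hbc
  · have := hthin'.card_lt hbc
    rw [hcard] at this
    exact this.false
  · have := hthin'.card_lt (hthin'.opp_arc hbc)
    rw [opp_opp, hcard] at this
    exact this.false
  · exact hloop u (opp u) rfl (hthin'.opp_arc_iff.1 hbc)

theorem IsCoding.fst_eq_fst_iff (h : T.IsCoding P G δ) {u v : Fin n × Bool} :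
    (δ u).fst = (δ v).fst ↔ u = v ∨ IsCriticalArc G (opp u) v := by
  rw [h.isCriticalArc_iff T.isTree, h.opp]
  constructor
  · intro h1
    by_cases huv : u = v
    · exact Or.inl huv
    · refine Or.inr ⟨h1, fun h2 => huv (δ.injective ?_)⟩
      exact SimpleGraph.Dart.symm_involutive.injective h2
  · rintro (rfl | ⟨h1, -⟩)
    · rfl
    · exact h1

theorem isCriticalArc_congr {V W : Type} {R : V → V → Prop} {Q : W → W → Prop} (ψ : V ≃ W)
    (hψ : ∀ u v, R u v ↔ Q (ψ u) (ψ v)) {u v : V} :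
    IsCriticalArc R u v ↔ IsCriticalArc Q (ψ u) (ψ v) := by
  have h1 : ∀ {a b}, Relation.TransGen R a b → Relation.TransGen Q (ψ a) (ψ b) :=
    fun h => Relation.TransGen.lift ψ (fun a b => (hψ a b).1) _ _ h
  have h2 : ∀ {a b}, Relation.TransGen Q (ψ a) (ψ b) → Relation.TransGen R a b := by
    intro a b h
    have := Relation.TransGen.lift (p := R) ψ.symm (fun a b h => (hψ _ _).2 (by simpa using h)) _ _ h
    simpa [Function.onFun] using this
  refine and_congr (hψ u v) (not_congr ⟨?_, ?_⟩)
  · rintro ⟨w, h3, h4, h5⟩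
    exact ⟨ψ w, (hψ _ _).1 h3, fun h => h4 (ψ.injective h), h1 h5⟩
  · rintro ⟨w, h3, h4, h5⟩
    obtain ⟨w, rfl⟩ := ψ.surjective w
    exact ⟨w, (hψ _ _).2 h3, fun h => h4 (h ▸ rfl), h2 h5⟩

theorem IsCoding.mtreeIso (h : T.IsCoding P G δ) (h' : T'.IsCoding P G' δ')
    (hsum : ∀ i, P i true + P i false = M) (hthin : IsThinSubgraph P G)
    (hthin' : IsThinSubgraph P G') (hiso : SubgraphIso P G G') : MTreeIso T T' := by
  obtain ⟨ψ, hψ, hP⟩ := hiso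
  have hopp := IsCoding.map_opp hsum hthin hthin' hψ hP
  let θ : T.G.Dart ≃ T'.G.Dart := δ.symm.trans (ψ.trans δ')
  have hθ : ∀ u, θ (δ u) = δ' (ψ u) := fun u => by simp [θ]
  have hθsymm : ∀ d, θ d.symm = (θ d).symm := by
    intro d
    obtain ⟨u, rfl⟩ := δ.surjective d
    rw [← h.opp, hθ, hθ, hopp, h'.opp]
  have hθfst : ∀ d e : T.G.Dart, d.fst = e.fst ↔ (θ d).fst = (θ e).fst := by
    intro d e
    obtain ⟨u, rfl⟩ := δ.surjective d
    obtain ⟨v, rfl⟩ := δ.surjective e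
    rw [hθ, hθ, h.fst_eq_fst_iff, h'.fst_eq_fst_iff, ← hopp, isCriticalArc_congr ψ hψ,
      ψ.injective.eq_iff]
  have hθpart : ∀ d, T'.part (θ d).fst (θ d).snd = T.part d.fst d.snd := by
    intro d
    obtain ⟨u, rfl⟩ := δ.surjective d
    rw [hθ, h.part, h'.part, hP]
  rcases isEmpty_or_nonempty T.G.Dart with hE | hE
  · have hE' : IsEmpty T'.G.Dart := θ.symm.isEmpty
    obtain ⟨x⟩ := T.connected.nonempty
    obtain ⟨y⟩ := T'.connected.nonempty
    refine ⟨⟨fun _ => y, fun _ => x, fun z => subsingleton_of_isEmpty_dart _ _,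
      fun z => subsingleton_of_isEmpty_dart _ _⟩, fun u v => ?_, fun v => ?_⟩
    · rw [subsingleton_of_isEmpty_dart u v]
      simp
    · have h1 := T.label_add_sum_part v
      have h2 := T'.label_add_sum_part y
      rw [Finset.univ_eq_empty, Finset.filter_empty, Finset.sum_empty, add_zero] at h1 h2
      exact h2.trans h1.symm
  · have hE' : Nonempty T'.G.Dart := hE.map θ
    choose out hout using fun x => exists_dart_fst (T := T) x
    choose out' hout' using fun x => exists_dart_fst (T := T') x
    have hφ : ∀ d : T.G.Dart, (θ (out d.fst)).fst = (θ d).fst := fun d =>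
      (hθfst _ _).1 (hout _)
    have hφ' : ∀ d : T'.G.Dart, (θ.symm (out' d.fst)).fst = (θ.symm d).fst := fun d => by
      rw [hθfst]
      simp [hout']
    let φ : Fin T.n ≃ Fin T'.n :=
      { toFun := fun x => (θ (out x)).fst
        invFun := fun x => (θ.symm (out' x)).fst
        left_inv := fun x => (hφ' _).trans (by simp [hout])
        right_inv := fun x => (hφ _).trans (by simp [hout']) }
    have hφd : ∀ d : T.G.Dart, φ d.fst = (θ d).fst := hφ
    have hφs : ∀ d : T.G.Dart, φ d.snd = (θ d).snd := fun d => by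
      have := hφd d.symm
      rw [hθsymm] at this
      exact this
    refine ⟨φ, fun u v => ⟨fun huv => ?_, fun huv => ?_⟩, fun x => ?_⟩
    · have h1 := hφd ⟨(u, v), huv⟩
      have h2 := hφs ⟨(u, v), huv⟩
      simp only at h1 h2
      rw [h1, h2]
      exact (θ _).adj
    · obtain ⟨d, hd⟩ := θ.surjective ⟨(φ u, φ v), huv⟩
      have h1 := hφd d
      have h2 := hφs d
      rw [hd] at h1 h2
      rw [← φ.injective h1, ← φ.injective h2]
      exact d.adj
    · have h1 := T.label_add_sum_part x
      have h2 := T'.label_add_sum_part (φ x)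
      refine add_right_cancel (b := ∑ e ∈ Finset.univ.filter (fun e : T.G.Dart => e.fst = x),
        T.part e.snd e.fst) (Eq.trans ?_ (h2.trans h1.symm))
      congr 1
      refine Finset.sum_equiv θ (fun e => ?_) fun e _ => ?_
      · simp only [Finset.mem_filter, Finset.mem_univ, true_and]
        rw [← hφd, φ.injective.eq_iff]
      · have := hθpart e.symm
        rw [hθsymm] at this
        exact this.symm

end MTree

/-- An orientation of the splits, choosing one part of each, is closed if it is an up-set
for `G`. -/
def IsClosedOrientation {n : ℕ} (G : Fin n × Bool → Fin n × Bool → Prop) (σ : Fin n → Bool) :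
    Prop :=
  ∀ u v : Fin n × Bool, G u v → σ u.1 = u.2 → σ v.1 = v.2

section Orientation

variable {X : Type} {M : Multiset X} {n : ℕ} {P : Fin n → Bool → Multiset X}
  {G : Fin n × Bool → Fin n × Bool → Prop}

theorem bool_eq_not_of_ne {a b : Bool} (h : a ≠ b) : a = !b := by
  cases a <;> cases b <;> simp_all

namespace IsThinSubgraph

theorem exists_opposite_source (h : IsThinSubgraph P G)
    (htrans : ∀ u v w, G u v → G v w → G u w) (i : Fin n) :
    ∃ σ : Fin n → Bool, ∀ b, IsClosedOrientation G (Function.update σ i b) := by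
  have hex : ∀ j, ∃ c, j ≠ i → ∃ b, G (i, b) (j, c) := by
    intro j
    by_cases hj : j = i
    · exact ⟨true, fun h => absurd hj h⟩
    · obtain ⟨b, c, hbc⟩ := h.exists_arc (Ne.symm hj)
      exact ⟨c, fun _ => ⟨b, hbc⟩⟩
  choose σ hσ using hex
  refine ⟨σ, fun b u v huv hu => ?_⟩
  have hchar : ∀ w : Fin n × Bool, w.1 ≠ i → (∃ b, G (i, b) w) → σ w.1 = w.2 := by
    rintro ⟨j, c⟩ hj ⟨b, hb⟩
    obtain ⟨b', hb'⟩ := hσ j hj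
    exact (h.eq_of_arc hb' hb).2
  have hne := (h.1 _ _ huv).1
  by_cases hui : u.1 = i
  · have hvi : v.1 ≠ i := fun h' => hne (hui.trans h'.symm)
    rw [Function.update_of_ne hvi]
    exact hchar v hvi ⟨u.2, by rw [← hui]; exact huv⟩
  · rw [Function.update_of_ne hui] at hu
    obtain ⟨b', hb'⟩ := hσ u.1 hui
    rw [hu] at hb'
    have hb'' := htrans _ _ _ hb' huv
    have hvi : v.1 ≠ i := fun h' => (h.1 _ _ hb'').1 h'.symm
    rw [Function.update_of_ne hvi]
    exact hchar v hvi ⟨b', hb''⟩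

theorem closedOrientation_eq (h : IsThinSubgraph P G) {i : Fin n} {σ τ : Fin n → Bool}
    (hσ : ∀ b, IsClosedOrientation G (Function.update σ i b))
    (hτ : ∀ b, IsClosedOrientation G (Function.update τ i b)) {j : Fin n} (hj : j ≠ i) :
    σ j = τ j := by
  obtain ⟨b, c, hbc⟩ := h.exists_arc (Ne.symm hj)
  have h1 := hσ b _ _ hbc (by simp)
  have h2 := hτ b _ _ hbc (by simp)
  simp only [Function.update_of_ne hj] at h1 h2
  rw [h1, h2]

theorem exists_flip (h : IsThinSubgraph P G) {σ τ : Fin n → Bool}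
    (hσ : IsClosedOrientation G σ) (hτ : IsClosedOrientation G τ) (hne : σ ≠ τ) :
    ∃ i, σ i ≠ τ i ∧ IsClosedOrientation G (Function.update σ i (τ i)) := by
  obtain ⟨i₀, hi₀⟩ := Function.ne_iff.1 hne
  obtain ⟨i, hi, hmin⟩ := Finset.exists_min_image (Finset.univ.filter fun i => σ i ≠ τ i)
    (fun i => (P i (σ i)).card) ⟨i₀, by simpa using hi₀⟩
  simp only [Finset.mem_filter, Finset.mem_univ, true_and] at hi hmin
  have hmin' : ∀ j, σ j ≠ τ j → ¬ G (j, σ j) (i, σ i) := fun j hj hG =>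
    (h.card_lt hG).not_ge (hmin j hj)
  refine ⟨i, hi, fun u v huv hu => ?_⟩
  obtain ⟨k, b⟩ := u
  obtain ⟨j, c⟩ := v
  have hkj : k ≠ j := (h.1 _ _ huv).1
  simp only at hu ⊢
  by_cases hk : k = i
  · subst hk
    rw [Function.update_self] at hu
    subst hu
    rw [Function.update_of_ne hkj.symm]
    have h1 : τ j = c := hτ _ _ huv rfl
    by_contra hj
    rw [← h1] at hj
    refine hmin' j hj ?_
    have h2 := h.opp_arc huv
    simp only [opp] at h2
    rwa [← h1, ← bool_eq_not_of_ne hj, ← bool_eq_not_of_ne hi] at h2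
  · rw [Function.update_of_ne hk] at hu
    subst hu
    have h1 : σ j = c := hσ _ _ huv rfl
    by_cases hj : j = i
    · subst hj
      subst h1
      exfalso
      by_cases hk' : σ k = τ k
      · exact hi (hτ _ _ huv hk'.symm).symm
      · exact hmin' k hk' huv
    · rw [Function.update_of_ne hj, h1]

end IsThinSubgraph

theorem exists_isDartCoding (h : IsThinSubgraph P G) (htrans : ∀ u v w, G u v → G v w → G u w) :
    ∃ (N : ℕ) (Gr : SimpleGraph (Fin N)) (δ : Fin n × Bool ≃ Gr.Dart), Gr.IsTree ∧
      IsDartCoding Gr G δ := by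
  let W := {σ : Fin n → Bool // IsClosedOrientation G σ}
  let e : W ≃ Fin (Fintype.card W) := Fintype.equivFin W
  let s : Fin (Fintype.card W) → Fin n → Bool := fun x => (e.symm x).1
  have hs : ∀ x, IsClosedOrientation G (s x) := fun x => (e.symm x).2
  have hsinj : Function.Injective s := fun x y hxy => e.symm.injective (Subtype.ext hxy)
  have hsurj : ∀ σ, IsClosedOrientation G σ → ∃ x, s x = σ := fun σ hσ =>
    ⟨e ⟨σ, hσ⟩, by simp [s]⟩
  clear_value s
  let Gr : SimpleGraph (Fin (Fintype.card W)) :=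
    { Adj := fun x y => ∃ i, s x i ≠ s y i ∧ ∀ j, j ≠ i → s x j = s y j
      symm := ⟨fun x y ⟨i, h1, h2⟩ => ⟨i, h1.symm, fun j hj => (h2 j hj).symm⟩⟩
      loopless := ⟨fun x ⟨i, h1, _⟩ => h1 rfl⟩ }
  have hadj : ∀ x y, Gr.Adj x y ↔ ∃ i, s x i ≠ s y i ∧ ∀ j, j ≠ i → s x j = s y j :=
    fun _ _ => Iff.rfl
  clear_value Gr
  choose base hbase using h.exists_opposite_source htrans
  choose src hsrc using fun u : Fin n × Bool => hsurj _ (hbase u.1 u.2)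
  have hsrc_self : ∀ u : Fin n × Bool, s (src u) u.1 = u.2 := fun u => by simp [hsrc]
  have hsrc_ne : ∀ (u : Fin n × Bool) j, j ≠ u.1 → s (src u) j = s (src (opp u)) j := by
    intro u j hj
    rw [hsrc, hsrc, Function.update_of_ne hj, opp_fst, Function.update_of_ne hj]
  have hsrc_adj : ∀ u, Gr.Adj (src u) (src (opp u)) := by
    intro u
    refine (hadj _ _).2 ⟨u.1, ?_, hsrc_ne u⟩
    have := hsrc_self (opp u)
    rw [opp_fst] at this
    rw [this, hsrc_self]
    simp
  have hadj_eq : ∀ x y i, s x i ≠ s y i → (∀ j, j ≠ i → s x j = s y j) →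
      x = src (i, s x i) := by
    intro x y i h1 h2
    apply hsinj
    have hx : ∀ b, IsClosedOrientation G (Function.update (s x) i b) := by
      intro b
      by_cases hb : b = s x i
      · rw [hb, Function.update_eq_self]
        exact hs x
      · have : Function.update (s x) i b = s y := by
          ext j
          by_cases hj : j = i
          · subst hj
            rw [Function.update_self, bool_eq_not_of_ne hb, bool_eq_not_of_ne h1, Bool.not_not]
          · rw [Function.update_of_ne hj, h2 j hj]
        rw [this]
        exact hs y
    rw [hsrc]
    ext j
    by_cases hj : j = i
    · subst hj
      simp
    · rw [Function.update_of_ne hj, h.closedOrientation_eq hx (hbase i) hj]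
  let F : Fin n × Bool → Gr.Dart := fun u => ⟨(src u, src (opp u)), hsrc_adj u⟩
  have hF : Function.Bijective F := by
    constructor
    · intro u v huv
      have h1 : src u = src v := congrArg (fun d => d.fst) huv
      have h2 : src (opp u) = src (opp v) := congrArg (fun d => d.snd) huv
      by_cases huv1 : u.1 = v.1
      · refine Prod.ext huv1 ?_
        rw [← hsrc_self u, ← hsrc_self v, h1, huv1]
      · have h3 := hsrc_ne v u.1 huv1
        rw [← h1, ← h2, hsrc_self] at h3
        have h4 := hsrc_self (opp u)
        rw [opp_fst, ← h3] at h4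
        simp at h4
    · intro d
      obtain ⟨i, h1, h2⟩ := (hadj _ _).1 d.adj
      refine ⟨(i, s d.fst i), SimpleGraph.Dart.ext _ _ (Prod.ext ?_ ?_)⟩
      · exact (hadj_eq _ _ i h1 h2).symm
      · have h3 := hadj_eq d.snd d.fst i h1.symm fun j hj => (h2 j hj).symm
        refine Eq.trans ?_ h3.symm
        rw [bool_eq_not_of_ne h1.symm]
        rfl
  let δ : Fin n × Bool ≃ Gr.Dart := Equiv.ofBijective F hF
  have hδ : ∀ u, δ u = ⟨(src u, src (opp u)), hsrc_adj u⟩ := fun _ => rfl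
  have hδopp : ∀ u, δ (opp u) = (δ u).symm := by
    intro u
    rw [hδ, hδ]
    exact SimpleGraph.Dart.ext _ _ (by simp)
  clear_value δ
  have hconn : Gr.Connected := by
    have hreach : ∀ (k : ℕ) x y, (Finset.univ.filter fun i => s x i ≠ s y i).card = k →
        Gr.Reachable x y := by
      intro k
      induction k with
      | zero =>
        intro x y hk
        rw [Finset.card_eq_zero, Finset.filter_eq_empty_iff] at hk
        rw [hsinj (funext fun i => not_not.1 (hk (Finset.mem_univ i)))]
      | succ k ih =>
        intro x y hk
        have hxy : s x ≠ s y := by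
          intro hxy
          simp [hxy] at hk
        obtain ⟨i, hi, hcl⟩ := h.exists_flip (hs x) (hs y) hxy
        obtain ⟨z, hz⟩ := hsurj _ hcl
        have hxz : Gr.Adj x z := (hadj _ _).2 ⟨i, by simpa [hz] using hi,
          fun j hj => by rw [hz, Function.update_of_ne hj]⟩
        refine hxz.reachable.trans (ih z y ?_)
        have : (Finset.univ.filter fun j => s z j ≠ s y j) =
            (Finset.univ.filter fun j => s x j ≠ s y j).erase i := by
          ext j
          by_cases hj : j = i
          · subst hj
            simp [hz]
          · simp [hz, hj]
        rw [this, Finset.card_erase_of_mem (by simpa using hi), hk]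
        rfl
    obtain ⟨x₀⟩ : Nonempty (Fin (Fintype.card W)) := by
      rcases isEmpty_or_nonempty (Fin n) with hn | ⟨⟨i⟩⟩
      · obtain ⟨x, -⟩ := hsurj (fun _ => true) fun u => isEmptyElim u.1
        exact ⟨x⟩
      · exact ⟨src (i, true)⟩
    have : Nonempty (Fin (Fintype.card W)) := ⟨x₀⟩
    exact ⟨fun x y => hreach _ x y rfl⟩
  have hdel : ∀ (u : Fin n × Bool) (x y : Fin (Fintype.card W)),
      (Gr.deleteEdges {s((δ u).fst, (δ u).snd)}).Reachable x y → s x u.1 = s y u.1 := by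
    rintro u x y ⟨p⟩
    induction p with
    | nil => rfl
    | @cons x z y hxz p ih =>
      rw [← ih]
      rw [SimpleGraph.deleteEdges_adj] at hxz
      by_contra hne
      obtain ⟨i, h1, h2⟩ := (hadj _ _).1 hxz.1
      have hi : u.1 = i := by
        by_contra hi
        exact hne (h2 _ hi)
      have hx := hadj_eq _ _ i h1 h2
      have hz := hadj_eq _ _ i h1.symm fun j hj => (h2 j hj).symm
      rw [bool_eq_not_of_ne h1.symm] at hz
      refine hxz.2 ?_
      rw [Set.mem_singleton_iff, hδ]
      rcases eq_or_eq_opp (u := (i, s x i)) (v := u) hi.symm with h3 | h3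
      · rw [h3] at hx
        have hz' : z = src (opp u) := by rw [← h3]; exact hz
        rw [hx, hz']
      · rw [h3] at hx
        have hz' : z = src u := by rw [← opp_opp (u := u), ← h3]; exact hz
        rw [hx, hz']
        exact Sym2.eq_swap
  have hacyc : Gr.IsAcyclic := by
    rw [SimpleGraph.isAcyclic_iff_forall_adj_isBridge]
    intro x y hxy
    rw [SimpleGraph.isBridge_iff]
    intro hr
    obtain ⟨u, hu⟩ := δ.surjective ⟨(x, y), hxy⟩
    have h1 := hdel u x y (by rw [hu]; exact hr)
    rw [hδ] at hu
    have h2 : src u = x := congrArg (fun d => d.fst) hu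
    have h3 : src (opp u) = y := congrArg (fun d => d.snd) hu
    have h4 := hsrc_self (opp u)
    rw [opp_fst, h3, ← h1, ← h2, hsrc_self] at h4
    simp at h4
  have hT : Gr.IsTree := ⟨hconn, hacyc⟩
  have hside : ∀ u z, z ∈ (δ u).side ↔ s z u.1 = u.2 := by
    have h1 : ∀ u z, z ∈ (δ u).side → s z u.1 = u.2 := by
      intro u z hz
      rw [← hdel u _ _ (SimpleGraph.Dart.mem_side.1 hz), hδ]
      exact hsrc_self u
    refine fun u z => ⟨h1 u z, fun hz => ?_⟩
    refine (SimpleGraph.Dart.mem_side_or hconn (δ u) z).resolve_right fun h2 => ?_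
    rw [← hδopp] at h2
    have h3 := h1 _ _ h2
    rw [opp_fst, hz] at h3
    simp at h3
  have harc : ∀ u v, G u v → (δ u).side ⊂ (δ v).side := by
    intro u v huv
    refine (Finset.ssubset_iff_of_subset fun z hz => ?_).2 ⟨src v, ?_, ?_⟩
    · rw [hside] at hz ⊢
      exact hs z u v huv hz
    · rw [hside, hsrc_self]
    · rw [hside]
      intro h1
      have h2 := hs (src (opp v)) u v huv
      rw [← hsrc_ne v _ (h.1 _ _ huv).1] at h2
      have h3 := hsrc_self (opp v)
      rw [opp_fst, h2 h1] at h3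
      simp at h3
  refine ⟨_, Gr, δ, hT, hδopp, fun u v => ⟨harc u v, fun huv => ?_⟩⟩
  have hne : u.1 ≠ v.1 := by
    intro h1
    rcases eq_or_eq_opp h1 with rfl | rfl
    · exact huv.ne rfl
    · rw [hδopp] at huv
      exact hT.mem_side_symm.1 (SimpleGraph.Dart.fst_mem_side _)
        (huv.subset (SimpleGraph.Dart.fst_mem_side _))
  obtain ⟨b, c, hbc⟩ := h.exists_arc hne
  have hu : (u.1, b) = u ∨ (u.1, b) = opp u := eq_or_eq_opp rfl
  have hv : (v.1, c) = v ∨ (v.1, c) = opp v := eq_or_eq_opp rfl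
  rcases hu with hu | hu <;> rcases hv with hv | hv <;> rw [hu, hv] at hbc
  · exact hbc
  · have h1 := (harc _ _ hbc).subset (SimpleGraph.Dart.fst_mem_side _)
    rw [hδopp, hT.mem_side_symm] at h1
    exact absurd (huv.subset (SimpleGraph.Dart.fst_mem_side _)) h1
  · have h1 := (harc _ _ (h.opp_arc hbc)).subset (SimpleGraph.Dart.fst_mem_side _)
    rw [opp_opp, hδopp] at h1
    exact absurd (huv.subset h1) (hT.mem_side_symm.1 (SimpleGraph.Dart.fst_mem_side _))
  · exact absurd (huv.trans (harc _ _ (h.opp_arc_iff.1 hbc))) (ssubset_irrefl _)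

theorem exists_mtree_isCoding (hne : ∀ i b, P i b ≠ 0) (hsum : ∀ i, P i true + P i false = M)
    (h : IsThinSubgraph P G) (hcon : IsConsistent P G) :
    ∃ (T : MTree X M) (δ : Fin n × Bool ≃ T.G.Dart), T.IsCoding P G δ := by
  obtain ⟨N, Gr, δ, hT, hδ⟩ := exists_isDartCoding h fun _ _ _ => h.trans hne hsum hcon
  let Q : Gr.Dart → Multiset X := fun d => P (δ.symm d).1 (δ.symm d).2
  have hQsymm : ∀ d, Q d + Q d.symm = M := by
    intro d
    obtain ⟨u, rfl⟩ := δ.surjective d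
    rw [← hδ.opp]
    simpa [Q] using part_add_part_opp hsum u
  have hQcon : ∀ d : Gr.Dart, ∑ e ∈ (Finset.univ.filter (fun e : Gr.Dart =>
      e.fst = d.fst)).erase d, Q e.symm ≤ Q d := by
    intro d
    have := hcon (δ.symm d)
    rwa [hδ.sum_isCriticalArc hT, Equiv.apply_symm_apply] at this
  have hQle : ∀ x, ∑ e ∈ Finset.univ.filter (fun e : Gr.Dart => e.fst = x), Q e.symm ≤ M := by
    intro x
    rcases (Finset.univ.filter (fun e : Gr.Dart => e.fst = x)).eq_empty_or_nonempty with h0 | h0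
    · rw [h0, Finset.sum_empty]
      exact Multiset.zero_le _
    · obtain ⟨d, hd⟩ := h0
      rw [← Finset.sum_erase_add _ _ hd, ← hQsymm d]
      obtain rfl : d.fst = x := by simpa using hd
      exact add_le_add_left (hQcon d) _
  choose label hlabel using fun x => Multiset.le_iff_exists_add.1 (hQle x)
  have hlab : ∀ x, label x + ∑ e ∈ Finset.univ.filter (fun e : Gr.Dart => e.fst = x),
      Q e.symm = M := fun x => by rw [add_comm, ← hlabel]
  have hlab' : ∀ d : Gr.Dart, label d.fst + ∑ e ∈ (Finset.univ.filter (fun e : Gr.Dart =>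
      e.fst = d.fst)).erase d, Q e.symm = Q d := by
    intro d
    have h1 := hlab d.fst
    rw [← Finset.sum_erase_add (a := d) _ _ (by simp), ← add_assoc] at h1
    exact add_right_cancel (h1.trans (hQsymm d).symm)
  have hpart : ∀ d : Gr.Dart, ∑ z ∈ d.side, label z = Q d := by
    intro d
    induction hk : d.side.card using Nat.strong_induction_on generalizing d with
    | _ k ih =>
    have h1 := hT.sum_eq_add_sum_darts label d.fst
    rw [← hT.sum_side_add_sum_side_symm label d, ← Finset.sum_erase_add (a := d) _ _ (by simp),
      ← add_assoc] at h1
    rw [add_right_cancel h1, ← hlab' d]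
    congr 1
    refine Finset.sum_congr rfl fun e he => ih _ ?_ e.symm rfl
    rw [← hk]
    refine Finset.card_lt_card (hT.side_ssubset_of_snd_eq_fst ?_ ?_)
    · simpa using (Finset.mem_erase.1 he).2
    · exact fun h' => (Finset.mem_erase.1 he).1
        (SimpleGraph.Dart.symm_involutive.injective h')
  have hm1 : ∑ v, label v = M := by
    obtain ⟨x⟩ := hT.connected.nonempty
    rw [hT.sum_eq_add_sum_darts label x, ← hlab x]
    simp only [hpart]
  have hm2 : ∀ v, Gr.degree v = 1 ∨ Gr.degree v = 2 → label v ≠ 0 := by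
    intro x hx h0
    have hcard : (Finset.univ.filter (fun e : Gr.Dart => e.fst = x)).card = Gr.degree x := by
      rw [← SimpleGraph.dart_fst_fiber_card_eq_degree]
    rw [← hcard, Finset.card_eq_one, Finset.card_eq_two] at hx
    rcases hx with ⟨d, hd⟩ | ⟨d, e, hde, hd⟩
    · have hdx : d.fst = x := by simpa using hd.ge (Finset.mem_singleton_self d)
      have h1 := hlab' d
      rw [hdx, hd, h0, Finset.erase_singleton, Finset.sum_empty, add_zero] at h1
      exact hne _ _ h1.symm
    · have hdx : d.fst = x := by simpa using hd.ge (Finset.mem_insert_self d _)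
      have hex : e.fst = x := by
        simpa using hd.ge (Finset.mem_insert_of_mem (Finset.mem_singleton_self e))
      have h1 := hlab' d
      rw [hdx, hd, h0, Finset.erase_insert (by simpa using hde), Finset.sum_singleton,
        zero_add] at h1
      have h2 : e.symm.side ⊂ d.side :=
        hT.side_ssubset_of_snd_eq_fst (hex.trans hdx.symm) fun h' =>
          hde (SimpleGraph.Dart.symm_involutive.injective h').symm
      have h3 := (h.1 (δ.symm e.symm) (δ.symm d) ((hδ.arc _ _).2 (by simpa using h2))).2
      exact h3.ne h1
  let T : MTree X M := ⟨N, Gr, hT.connected, hT.isAcyclic, label, hm1, hm2⟩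
  refine ⟨T, δ, hδ, fun u => ?_⟩
  rw [T.part_eq_sum_side]
  refine (hpart (δ u)).trans ?_
  simp [Q]

end Orientation

/-- Corollary: counting representations. Let `𝔖` be a compatible
split system on `M`. Then the isomorphism classes of `M`-trees representing `𝔖` are
in bijective correspondence with the isomorphism classes of consistent thin subgraphs
of `Γ(𝔖)`; in particular, `𝔖` has a unique representation up to isomorphism iff
`Γ(𝔖)` has a unique consistent thin subgraph up to isomorphism. -/
theorem stmt4 {X : Type} [DecidableEq X] (M : Multiset X) {n : ℕ}
    (P : Fin n → Bool → Multiset X)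
    (hne : ∀ i b, P i b ≠ 0) (hsum : ∀ i, P i true + P i false = M)
    (hcomp : Compatible M (splitSystemOf P)) :
    (∃ f : {T : MTree X M // T.splits = splitSystemOf P} →
        {G : Fin n × Bool → Fin n × Bool → Prop // IsThinSubgraph P G ∧ IsConsistent P G},
      (∀ T T' : {T : MTree X M // T.splits = splitSystemOf P},
        MTreeIso T.1 T'.1 ↔ SubgraphIso P (f T).1 (f T').1) ∧
      (∀ G : {G : Fin n × Bool → Fin n × Bool → Prop //
          IsThinSubgraph P G ∧ IsConsistent P G},
        ∃ T : {T : MTree X M // T.splits = splitSystemOf P},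
          SubgraphIso P (f T).1 G.1)) ∧
    ((∀ T T' : {T : MTree X M // T.splits = splitSystemOf P}, MTreeIso T.1 T'.1) ↔
      (∀ G G' : {G : Fin n × Bool → Fin n × Bool → Prop //
          IsThinSubgraph P G ∧ IsConsistent P G}, SubgraphIso P G.1 G'.1)) := by
  choose F hF δ hδ using fun T : {T : MTree X M // T.splits = splitSystemOf P} =>
    T.1.exists_isCoding hne T.2
  let f : {T : MTree X M // T.splits = splitSystemOf P} →
      {G : Fin n × Bool → Fin n × Bool → Prop // IsThinSubgraph P G ∧ IsConsistent P G} :=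
    fun T => ⟨F T, hF T⟩
  have hf : ∀ T T' : {T : MTree X M // T.splits = splitSystemOf P},
      MTreeIso T.1 T'.1 ↔ SubgraphIso P (f T).1 (f T').1 := fun T T' =>
    ⟨(hδ T).subgraphIso (hδ T'), (hδ T).mtreeIso (hδ T') hsum (hF T).1 (hF T').1⟩
  have hsurj : ∀ G : {G : Fin n × Bool → Fin n × Bool → Prop //
      IsThinSubgraph P G ∧ IsConsistent P G},
      ∃ T : {T : MTree X M // T.splits = splitSystemOf P}, SubgraphIso P (f T).1 G.1 := by
    intro G
    obtain ⟨T, ε, hε⟩ := exists_mtree_isCoding hne hsum G.2.1 G.2.2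
    refine ⟨⟨T, T.splits_eq_map_univ ε hε.opp hε.part⟩, (hδ _).subgraphIso hε ?_⟩
    exact ⟨Equiv.refl _, fun _ _ => Iff.rfl, fun _ => rfl⟩
  refine ⟨⟨f, hf, hsurj⟩, fun h G G' => ?_, fun h T T' => (hf T T').2 (h _ _)⟩
  obtain ⟨T, φ, hφ, hφP⟩ := hsurj G
  obtain ⟨T', φ', hφ', hφP'⟩ := hsurj G'
  obtain ⟨ψ, hψ, hψP⟩ := (hf T T').1 (h T T')
  refine ⟨φ.symm.trans (ψ.trans φ'), fun u v => ?_, fun u => ?_⟩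
  · simp only [Equiv.trans_apply]
    rw [← hφ', ← hψ, hφ, Equiv.apply_symm_apply, Equiv.apply_symm_apply]
  · simp only [Equiv.trans_apply]
    rw [hφP', hψP, ← hφP, Equiv.apply_symm_apply]
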